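/- Let S be a Boolean inverse monoid that is completely semisimple and in which D preserves complementation (a Foulis monoid). Then (E(S)/D, ⊕, [0], [1]), with complementation [e]' = [ē], is an effect algebra satisfying the refinement property. -/

import Mathlib

namespace Coordinatization

/-- The data of a monoid with zero equipped with an inverse operation. -/
structure InvMonData (S : Type) where
  mul : S → S → S
  one : S
  zero : S
  inv : S → S

variable {S T : Type}

/-- `M` is an inverse monoid with zero: a monoid with zero in which every element `a`
has a unique generalized inverse `a⁻¹`. -/
structure IsInverseMonoid (M : InvMonData S) : Prop where
  mul_assoc : ∀ a b c, M.mul (M.mul a b) c = M.mul a (M.mul b c)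
  one_mul : ∀ a, M.mul M.one a = a
  mul_one : ∀ a, M.mul a M.one = a
  zero_mul : ∀ a, M.mul M.zero a = M.zero
  mul_zero : ∀ a, M.mul a M.zero = M.zero
  inv_law₁ : ∀ a, M.mul (M.mul a (M.inv a)) a = a
  inv_law₂ : ∀ a, M.mul (M.mul (M.inv a) a) (M.inv a) = M.inv a
  inv_unique : ∀ a b, M.mul (M.mul a b) a = a → M.mul (M.mul b a) b = b → b = M.inv a

/-- `e` is an idempotent. -/
def IsIdem (M : InvMonData S) (e : S) : Prop := M.mul e e = e

/-- The natural partial order: `a ≤ b` iff `a = b·e` for some idempotent `e`. -/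
def nle (M : InvMonData S) (a b : S) : Prop := ∃ e, IsIdem M e ∧ a = M.mul b e

/-- `a` and `b` are compatible: `a⁻¹b` and `ab⁻¹` are both idempotents. -/
def Compatible (M : InvMonData S) (a b : S) : Prop :=
  IsIdem M (M.mul (M.inv a) b) ∧ IsIdem M (M.mul a (M.inv b))

/-- `a` and `b` are orthogonal: `a⁻¹b = 0 = ab⁻¹`. -/
def Orthogonal (M : InvMonData S) (a b : S) : Prop :=
  M.mul (M.inv a) b = M.zero ∧ M.mul a (M.inv b) = M.zero

/-- `j` is the join of `a` and `b` with respect to the natural partial order. -/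
def IsJoin (M : InvMonData S) (a b j : S) : Prop :=
  nle M a j ∧ nle M b j ∧ ∀ c, nle M a c → nle M b c → nle M j c

/-- `m` is the meet of `a` and `b` with respect to the natural partial order. -/
def IsMeet (M : InvMonData S) (a b m : S) : Prop :=
  nle M m a ∧ nle M m b ∧ ∀ c, nle M c a → nle M c b → nle M c m

/-- Green's relation `D`: `e D f` iff there is `a` with `a⁻¹a = e` and `aa⁻¹ = f`. -/
def DRel (M : InvMonData S) (e f : S) : Prop :=
  ∃ a, M.mul (M.inv a) a = e ∧ M.mul a (M.inv a) = f

/-- `f` is a Boolean complement of the idempotent `e` in the Boolean algebra of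
idempotents: `e·f = 0` and `e ∨ f = 1`. -/
def IsComplPair (M : InvMonData S) (e f : S) : Prop :=
  IsIdem M e ∧ IsIdem M f ∧ M.mul e f = M.zero ∧ IsJoin M e f M.one

/-- A Boolean inverse monoid: an inverse monoid with zero in which the idempotents form a
Boolean algebra under the natural partial order (meets of idempotents are given by products;
complements exist), all compatible binary joins exist, and multiplication distributes over
binary joins. -/
structure IsBooleanInverseMonoid (M : InvMonData S) : Prop where
  invMon : IsInverseMonoid M
  joins_exist : ∀ a b, Compatible M a b → ∃ j, IsJoin M a b j
  mul_join_left : ∀ c a b j, IsJoin M a b j → IsJoin M (M.mul c a) (M.mul c b) (M.mul c j)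
  mul_join_right : ∀ c a b j, IsJoin M a b j → IsJoin M (M.mul a c) (M.mul b c) (M.mul j c)
  compl_exists : ∀ e, IsIdem M e → ∃ f, IsComplPair M e f

/-- The relation `D` preserves complementation: `e D f` implies `ē D f̄`. -/
def DPreservesCompl (M : InvMonData S) : Prop :=
  ∀ e f e' f', DRel M e f → IsComplPair M e e' → IsComplPair M f f' → DRel M e' f'

/-- `M` is completely semisimple: `e D f ≤ e` implies `e = f` for idempotents. -/
def CompletelySemisimple (M : InvMonData S) : Prop :=
  ∀ e f, IsIdem M e → IsIdem M f → DRel M e f → nle M f e → e = f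

/-- A Foulis monoid: a completely semisimple Boolean inverse monoid in which `D`
preserves complementation. -/
def IsFoulis (M : InvMonData S) : Prop :=
  IsBooleanInverseMonoid M ∧ CompletelySemisimple M ∧ DPreservesCompl M

/-- The preorder underlying `S/J`: `Jle s t` iff `SsS ⊆ StS`, i.e. `s = a·t·b` for some `a, b`. -/
def Jle (M : InvMonData S) (s t : S) : Prop := ∃ a b, s = M.mul (M.mul a t) b

/-- `S/J`, the poset of principal ideals, is a lattice. -/
def LatticeCondition (M : InvMonData S) : Prop :=
  ∀ s t : S,
    (∃ m, Jle M m s ∧ Jle M m t ∧ ∀ c, Jle M c s → Jle M c t → Jle M c m) ∧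
    (∃ j, Jle M s j ∧ Jle M t j ∧ ∀ c, Jle M s c → Jle M t c → Jle M j c)

/-- `[e] ⊕ [f] = [g]` in `E(S)/D`: there are orthogonal idempotents `e' D e` and `f' D f`
whose join is `D`-related to `g`. -/
def OplusEq (M : InvMonData S) (e f g : S) : Prop :=
  ∃ e' f' j, IsIdem M e' ∧ IsIdem M f' ∧ DRel M e e' ∧ DRel M f f' ∧
    M.mul e' f' = M.zero ∧ IsJoin M e' f' j ∧ DRel M j g

/-- `M` is fundamental: only idempotents commute with every idempotent. -/
def Fundamental (M : InvMonData S) : Prop :=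
  ∀ s, (∀ e, IsIdem M e → M.mul s e = M.mul e s) → IsIdem M s

/-- `M` is factorizable: every element lies beneath a unit. -/
def Factorizable (M : InvMonData S) : Prop :=
  ∀ s, ∃ g, M.mul g (M.inv g) = M.one ∧ M.mul (M.inv g) g = M.one ∧ nle M s g

/-- All binary meets exist (`∧`-monoid). -/
def HasMeets (M : InvMonData S) : Prop := ∀ a b, ∃ m, IsMeet M a b m

/-- A morphism of Boolean inverse `∧`-monoids: a monoid homomorphism mapping zero to zero,
preserving binary compatible joins and binary meets. -/
def IsMorphism (M : InvMonData S) (N : InvMonData T) (f : S → T) : Prop :=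
  f M.one = N.one ∧ f M.zero = N.zero ∧
  (∀ a b, f (M.mul a b) = N.mul (f a) (f b)) ∧
  (∀ a b j, Compatible M a b → IsJoin M a b j → IsJoin N (f a) (f b) (f j)) ∧
  (∀ a b m, IsMeet M a b m → IsMeet N (f a) (f b) (f m))

end Coordinatization
namespace Coordinatization

namespace IsInverseMonoid

variable {M : InvMonData S} {a b c e f j : S}

theorem idem_inv_mul (hM : IsInverseMonoid M) (a : S) : IsIdem M (M.mul (M.inv a) a) := by
  unfold IsIdem
  rw [← hM.mul_assoc, hM.inv_law₂]

theorem idem_mul_inv (hM : IsInverseMonoid M) (a : S) : IsIdem M (M.mul a (M.inv a)) := by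
  unfold IsIdem
  rw [← hM.mul_assoc, hM.inv_law₁]

theorem idem_zero (hM : IsInverseMonoid M) : IsIdem M M.zero := hM.zero_mul _

theorem idem_one (hM : IsInverseMonoid M) : IsIdem M M.one := hM.one_mul _

theorem inv_eq_self (hM : IsInverseMonoid M) (he : IsIdem M e) : M.inv e = e := by
  have h : M.mul (M.mul e e) e = e := by rw [he, he]
  exact (hM.inv_unique e e h h).symm

theorem inv_inv (hM : IsInverseMonoid M) (a : S) : M.inv (M.inv a) = a :=
  (hM.inv_unique (M.inv a) a (hM.inv_law₂ a) (hM.inv_law₁ a)).symm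

theorem idem_mul_idem (hM : IsInverseMonoid M) (he : IsIdem M e) (hf : IsIdem M f) :
    IsIdem M (M.mul e f) := by
  have he' : ∀ z, M.mul e (M.mul e z) = M.mul e z := fun z => by rw [← hM.mul_assoc, he]
  have hf' : ∀ z, M.mul f (M.mul f z) = M.mul f z := fun z => by rw [← hM.mul_assoc, hf]
  obtain ⟨x, hx⟩ : ∃ x, x = M.inv (M.mul e f) := ⟨_, rfl⟩
  have h1 := hM.inv_law₁ (M.mul e f)
  have h2 := hM.inv_law₂ (M.mul e f)
  rw [← hx] at h1 h2
  have h2e : M.mul x (M.mul e (M.mul f (M.mul x e))) = M.mul x e := by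
    simpa only [hM.mul_assoc] using congrArg (M.mul · e) h2
  have hfxe : M.mul (M.mul f x) e = x := by
    conv_rhs => rw [hx]
    apply hM.inv_unique
    · simpa only [hM.mul_assoc, he', hf'] using h1
    · simp only [hM.mul_assoc, he', hf', h2e]
  have hxx : M.mul x x = x := by
    conv_lhs => rw [← hfxe]
    simp only [hM.mul_assoc, h2e]
    simpa only [hM.mul_assoc] using hfxe
  have hef : M.mul e f = x := by
    rw [← hM.inv_inv (M.mul e f), ← hx, hM.inv_eq_self hxx]
  rw [hef]
  exact hxx

theorem idem_comm (hM : IsInverseMonoid M) (he : IsIdem M e) (hf : IsIdem M f) :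
    M.mul e f = M.mul f e := by
  have he' : ∀ z, M.mul e (M.mul e z) = M.mul e z := fun z => by rw [← hM.mul_assoc, he]
  have hf' : ∀ z, M.mul f (M.mul f z) = M.mul f z := fun z => by rw [← hM.mul_assoc, hf]
  have hef := hM.idem_mul_idem he hf
  have hfe := hM.idem_mul_idem hf he
  rw [← hM.inv_eq_self hef]
  refine (hM.inv_unique _ _ ?_ ?_).symm
  · simpa only [IsIdem, hM.mul_assoc, he', hf'] using hef
  · simpa only [IsIdem, hM.mul_assoc, he', hf'] using hfe

theorem mul_inv_rev (hM : IsInverseMonoid M) (a b : S) :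
    M.inv (M.mul a b) = M.mul (M.inv b) (M.inv a) := by
  have hc := hM.idem_comm (hM.idem_mul_inv b) (hM.idem_inv_mul a)
  refine (hM.inv_unique _ _ ?_ ?_).symm
  · calc M.mul (M.mul (M.mul a b) (M.mul (M.inv b) (M.inv a))) (M.mul a b)
        = M.mul (M.mul a (M.mul (M.mul b (M.inv b)) (M.mul (M.inv a) a))) b := by
          simp only [hM.mul_assoc]
      _ = M.mul (M.mul (M.mul a (M.inv a)) a) (M.mul (M.mul b (M.inv b)) b) := by
          rw [hc]; simp only [hM.mul_assoc]
      _ = M.mul a b := by rw [hM.inv_law₁, hM.inv_law₁]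
  · calc M.mul (M.mul (M.mul (M.inv b) (M.inv a)) (M.mul a b)) (M.mul (M.inv b) (M.inv a))
        = M.mul (M.mul (M.inv b) (M.mul (M.mul (M.inv a) a) (M.mul b (M.inv b)))) (M.inv a) := by
          simp only [hM.mul_assoc]
      _ = M.mul (M.mul (M.mul (M.inv b) b) (M.inv b))
            (M.mul (M.mul (M.inv a) a) (M.inv a)) := by
          rw [← hc]; simp only [hM.mul_assoc]
      _ = M.mul (M.inv b) (M.inv a) := by rw [hM.inv_law₂, hM.inv_law₂]

theorem dRel_refl (hM : IsInverseMonoid M) (he : IsIdem M e) : DRel M e e :=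
  ⟨e, by rw [hM.inv_eq_self he, he], by rw [hM.inv_eq_self he, he]⟩

theorem dRel_symm (hM : IsInverseMonoid M) : DRel M e f → DRel M f e := by
  rintro ⟨a, h1, h2⟩
  exact ⟨M.inv a, by rwa [hM.inv_inv], by rwa [hM.inv_inv]⟩

theorem dRel_trans (hM : IsInverseMonoid M) : DRel M e f → DRel M f j → DRel M e j := by
  rintro ⟨a, rfl, ha⟩ ⟨b, hb, rfl⟩
  refine ⟨M.mul b a, ?_, ?_⟩
  · calc M.mul (M.inv (M.mul b a)) (M.mul b a)
        = M.mul (M.inv a) (M.mul (M.mul (M.inv b) b) a) := by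
          rw [hM.mul_inv_rev]; simp only [hM.mul_assoc]
      _ = M.mul (M.inv a) a := by rw [hb, ← ha, hM.inv_law₁]
  · calc M.mul (M.mul b a) (M.inv (M.mul b a))
        = M.mul b (M.mul (M.mul a (M.inv a)) (M.inv b)) := by
          rw [hM.mul_inv_rev]; simp only [hM.mul_assoc]
      _ = M.mul b (M.inv b) := by rw [ha, ← hb, hM.inv_law₂]

theorem dRel_idem_left (hM : IsInverseMonoid M) : DRel M e f → IsIdem M e := by
  rintro ⟨a, rfl, -⟩
  exact hM.idem_inv_mul a

theorem dRel_idem_right (hM : IsInverseMonoid M) (h : DRel M e f) : IsIdem M f :=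
  hM.dRel_idem_left (hM.dRel_symm h)

theorem nle_refl (hM : IsInverseMonoid M) (a : S) : nle M a a :=
  ⟨M.one, hM.idem_one, (hM.mul_one a).symm⟩

theorem nle_trans (hM : IsInverseMonoid M) : nle M a b → nle M b c → nle M a c := by
  rintro ⟨e, he, rfl⟩ ⟨f, hf, rfl⟩
  exact ⟨M.mul f e, hM.idem_mul_idem hf he, hM.mul_assoc _ _ _⟩

theorem nle_one (hM : IsInverseMonoid M) (he : IsIdem M e) : nle M e M.one :=
  ⟨e, he, (hM.one_mul e).symm⟩

theorem idem_of_nle_one (hM : IsInverseMonoid M) : nle M a M.one → IsIdem M a := by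
  rintro ⟨e, he, rfl⟩
  rwa [hM.one_mul]

theorem zero_nle (hM : IsInverseMonoid M) (a : S) : nle M M.zero a :=
  ⟨M.zero, hM.idem_zero, (hM.mul_zero a).symm⟩

theorem eq_zero_of_nle_zero (hM : IsInverseMonoid M) : nle M a M.zero → a = M.zero := by
  rintro ⟨e, -, rfl⟩
  exact hM.zero_mul e

theorem mul_eq_right_of_nle (hM : IsInverseMonoid M) (hj : IsIdem M j) :
    nle M e j → M.mul j e = e := by
  rintro ⟨f, -, rfl⟩
  rw [← hM.mul_assoc, hj]

theorem mul_eq_left_of_nle (hM : IsInverseMonoid M) (he : IsIdem M e) (hj : IsIdem M j)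
    (h : nle M e j) : M.mul e j = e := by
  rw [hM.idem_comm he hj, hM.mul_eq_right_of_nle hj h]

theorem idem_of_isJoin (hM : IsInverseMonoid M) (he : IsIdem M e) (hf : IsIdem M f)
    (h : IsJoin M e f j) : IsIdem M j :=
  hM.idem_of_nle_one (h.2.2 _ (hM.nle_one he) (hM.nle_one hf))

theorem isJoin_zero_left (hM : IsInverseMonoid M) (a : S) : IsJoin M M.zero a a :=
  ⟨hM.zero_nle a, hM.nle_refl a, fun _ _ h => h⟩

theorem mul_eq_zero_comm (hM : IsInverseMonoid M) (he : IsIdem M e) (hf : IsIdem M f)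
    (h : M.mul e f = M.zero) : M.mul f e = M.zero := by
  rw [hM.idem_comm hf he, h]

end IsInverseMonoid

theorem IsJoin.symm {M : InvMonData S} {a b j : S} (h : IsJoin M a b j) : IsJoin M b a j :=
  ⟨h.2.1, h.1, fun c hb ha => h.2.2 c ha hb⟩

theorem OplusEq.symm {M : InvMonData S} (hM : IsInverseMonoid M) {e f g : S} :
    OplusEq M e f g → OplusEq M f e g := by
  rintro ⟨e', f', j, he, hf, hee, hff, h0, hj, hjg⟩
  exact ⟨f', e', j, hf, he, hff, hee, hM.mul_eq_zero_comm he hf h0, hj.symm, hjg⟩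

namespace IsBooleanInverseMonoid

variable {M : InvMonData S}

/-- A decomposition of `j` into orthogonal idempotents transports along `D`. -/
theorem exists_isJoin_of_dRel (hB : IsBooleanInverseMonoid M) {e f j k : S}
    (he : IsIdem M e) (hf : IsIdem M f) (h0 : M.mul e f = M.zero) (hj : IsJoin M e f j)
    (hjk : DRel M j k) :
    ∃ e' f', IsIdem M e' ∧ IsIdem M f' ∧ DRel M e e' ∧ DRel M f f' ∧
      M.mul e' f' = M.zero ∧ IsJoin M e' f' k := by
  have hM := hB.invMon
  obtain ⟨a, ha, rfl⟩ := hjk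
  have conj : ∀ x, IsIdem M x → nle M x j →
      DRel M x (M.mul (M.mul a x) (M.inv a)) := by
    intro x hx hxj
    refine ⟨M.mul a x, ?_, ?_⟩
    · calc M.mul (M.inv (M.mul a x)) (M.mul a x)
          = M.mul x (M.mul (M.mul (M.inv a) a) x) := by
            rw [hM.mul_inv_rev, hM.inv_eq_self hx]; simp only [hM.mul_assoc]
        _ = x := by
            rw [ha, hM.mul_eq_right_of_nle (hM.idem_of_isJoin he hf hj) hxj, hx]
    · calc M.mul (M.mul a x) (M.inv (M.mul a x))
          = M.mul (M.mul a (M.mul x x)) (M.inv a) := by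
            rw [hM.mul_inv_rev, hM.inv_eq_self hx]; simp only [hM.mul_assoc]
        _ = M.mul (M.mul a x) (M.inv a) := by rw [hx]
  have hde := conj e he hj.1
  have hdf := conj f hf hj.2.1
  refine ⟨_, _, hM.dRel_idem_right hde, hM.dRel_idem_right hdf, hde, hdf, ?_, ?_⟩
  · calc M.mul (M.mul (M.mul a e) (M.inv a)) (M.mul (M.mul a f) (M.inv a))
        = M.mul (M.mul a (M.mul e (M.mul (M.mul (M.inv a) a) f))) (M.inv a) := by
          simp only [hM.mul_assoc]
      _ = M.zero := by
          rw [ha, hM.mul_eq_right_of_nle (hM.idem_of_isJoin he hf hj) hj.2.1, h0,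
            hM.mul_zero, hM.zero_mul]
  · have h := hB.mul_join_right (M.inv a) _ _ _ (hB.mul_join_left a _ _ _ hj)
    have haj : M.mul a j = a := by rw [← ha, ← hM.mul_assoc, hM.inv_law₁]
    rwa [haj] at h

/-- In `[e] ⊕ [f] = [g]`, the orthogonal representatives may be chosen with join `g`. -/
theorem exists_isJoin_of_oplusEq (hB : IsBooleanInverseMonoid M) {e f g : S} :
    OplusEq M e f g → ∃ e' f', IsIdem M e' ∧ IsIdem M f' ∧ DRel M e e' ∧ DRel M f f' ∧
      M.mul e' f' = M.zero ∧ IsJoin M e' f' g := by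
  rintro ⟨e', f', j, he, hf, hee, hff, h0, hj, hjg⟩
  obtain ⟨e₂, f₂, he₂, hf₂, hee₂, hff₂, h⟩ := hB.exists_isJoin_of_dRel he hf h0 hj hjg
  exact ⟨e₂, f₂, he₂, hf₂, hB.invMon.dRel_trans hee hee₂, hB.invMon.dRel_trans hff hff₂, h⟩

theorem exists_isJoin_of_mul_eq_zero (hB : IsBooleanInverseMonoid M) {e f : S}
    (he : IsIdem M e) (hf : IsIdem M f) (h0 : M.mul e f = M.zero) : ∃ j, IsJoin M e f j := by
  refine hB.joins_exist e f ⟨?_, ?_⟩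
  · rw [hB.invMon.inv_eq_self he, h0]; exact hB.invMon.idem_zero
  · rw [hB.invMon.inv_eq_self hf, h0]; exact hB.invMon.idem_zero

theorem oplusEq_assoc (hB : IsBooleanInverseMonoid M) {e f g x h : S}
    (hx : OplusEq M e f x) (hh : OplusEq M x g h) :
    ∃ y, OplusEq M f g y ∧ OplusEq M e y h := by
  have hM := hB.invMon
  obtain ⟨e₁, f₁, he₁, hf₁, hee₁, hff₁, h₁, hj₁⟩ := hB.exists_isJoin_of_oplusEq hx
  obtain ⟨x', g', j, hx', hg', hxx', hgg', hxg, hj, hjh⟩ := hh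
  obtain ⟨e', f', he', hf', hee', hff', hef, hj'⟩ :=
    hB.exists_isJoin_of_dRel he₁ hf₁ h₁ hj₁ hxx'
  have below : ∀ z, IsIdem M z → nle M z x' → M.mul z g' = M.zero := by
    intro z hz hzx
    rw [← hM.mul_eq_left_of_nle hz hx' hzx, hM.mul_assoc, hxg, hM.mul_zero]
  have hfg := below f' hf' hj'.2.1
  obtain ⟨y, hy⟩ := hB.exists_isJoin_of_mul_eq_zero hf' hg' hfg
  have hyi := hM.idem_of_isJoin hf' hg' hy
  have hey : M.mul e' y = M.zero := by
    have h := hB.mul_join_left e' _ _ _ hy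
    rw [hef, below e' he' hj'.1] at h
    exact hM.eq_zero_of_nle_zero (h.2.2 _ (hM.nle_refl _) (hM.nle_refl _))
  refine ⟨y, ⟨f', g', y, hf', hg', hM.dRel_trans hff₁ hff', hgg', hfg, hy, hM.dRel_refl hyi⟩,
    e', y, j, he', hyi, hM.dRel_trans hee₁ hee', hM.dRel_refl hyi, hey, ⟨?_, ?_, ?_⟩, hjh⟩
  · exact hM.nle_trans hj'.1 hj.1
  · exact hy.2.2 _ (hM.nle_trans hj'.2.1 hj.1) hj.2.1
  · intro c hec hyc
    exact hj.2.2 _ (hj'.2.2 _ hec (hM.nle_trans hy.1 hyc)) (hM.nle_trans hy.2.1 hyc)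

theorem oplusEq_mul_of_isJoin (hB : IsBooleanInverseMonoid M) {a a' e f v : S}
    (ha : IsIdem M a) (he : IsIdem M e) (hf : IsIdem M f) (h0 : M.mul e f = M.zero)
    (hj : IsJoin M e f v) (hav : nle M a v) (haa' : DRel M a a') :
    OplusEq M (M.mul a e) (M.mul a f) a' := by
  have hM := hB.invMon
  have hae := hM.idem_mul_idem ha he
  have haf := hM.idem_mul_idem ha hf
  refine ⟨_, _, a, hae, haf, hM.dRel_refl hae, hM.dRel_refl haf, ?_, ?_, haa'⟩
  · rw [hM.idem_comm ha hf, hM.mul_assoc, ← hM.mul_assoc e f a, h0, hM.zero_mul, hM.mul_zero]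
  · have h := hB.mul_join_left a _ _ _ hj
    rwa [hM.mul_eq_left_of_nle ha (hM.idem_of_isJoin he hf hj) hav] at h

theorem oplusEq_refinement (hB : IsBooleanInverseMonoid M) {a₁ a₂ b₁ b₂ v : S}
    (ha : OplusEq M a₁ a₂ v) (hb : OplusEq M b₁ b₂ v) :
    ∃ c₁₁ c₁₂ c₂₁ c₂₂, IsIdem M c₁₁ ∧ IsIdem M c₁₂ ∧ IsIdem M c₂₁ ∧ IsIdem M c₂₂ ∧
      OplusEq M c₁₁ c₁₂ a₁ ∧ OplusEq M c₂₁ c₂₂ a₂ ∧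
      OplusEq M c₁₁ c₂₁ b₁ ∧ OplusEq M c₁₂ c₂₂ b₂ := by
  have hM := hB.invMon
  obtain ⟨x₁, x₂, hx₁, hx₂, hax₁, hax₂, hx, hxv⟩ := hB.exists_isJoin_of_oplusEq ha
  obtain ⟨y₁, y₂, hy₁, hy₂, hby₁, hby₂, hy, hyv⟩ := hB.exists_isJoin_of_oplusEq hb
  refine ⟨M.mul x₁ y₁, M.mul x₁ y₂, M.mul x₂ y₁, M.mul x₂ y₂,
    hM.idem_mul_idem hx₁ hy₁, hM.idem_mul_idem hx₁ hy₂, hM.idem_mul_idem hx₂ hy₁,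
    hM.idem_mul_idem hx₂ hy₂,
    hB.oplusEq_mul_of_isJoin hx₁ hy₁ hy₂ hy hyv hxv.1 (hM.dRel_symm hax₁),
    hB.oplusEq_mul_of_isJoin hx₂ hy₁ hy₂ hy hyv hxv.2.1 (hM.dRel_symm hax₂), ?_, ?_⟩
  · rw [hM.idem_comm hx₁ hy₁, hM.idem_comm hx₂ hy₁]
    exact hB.oplusEq_mul_of_isJoin hy₁ hx₁ hx₂ hx hxv hyv.1 (hM.dRel_symm hby₁)
  · rw [hM.idem_comm hx₁ hy₂, hM.idem_comm hx₂ hy₂]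
    exact hB.oplusEq_mul_of_isJoin hy₂ hx₁ hx₂ hx hxv hyv.2.1 (hM.dRel_symm hby₂)

theorem oplusEq_one_of_isComplPair (hB : IsBooleanInverseMonoid M) {e e' : S}
    (h : IsComplPair M e e') : OplusEq M e e' M.one :=
  ⟨e, e', M.one, h.1, h.2.1, hB.invMon.dRel_refl h.1, hB.invMon.dRel_refl h.2.1, h.2.2.1,
    h.2.2.2, hB.invMon.dRel_refl hB.invMon.idem_one⟩

theorem oplusEq_one_left_iff (hB : IsBooleanInverseMonoid M) (hcss : CompletelySemisimple M)
    {e : S} : (∃ g, OplusEq M e M.one g) ↔ DRel M e M.zero := by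
  have hM := hB.invMon
  constructor
  · rintro ⟨_, e', f', _, _, hf', hee', hf, h0, _⟩
    rw [← hcss _ _ hM.idem_one hf' hf (hM.nle_one hf'), hM.mul_one] at h0
    rwa [← h0]
  · intro h
    exact ⟨M.one, M.zero, M.one, M.one, hM.idem_zero, hM.idem_one, h, hM.dRel_refl hM.idem_one,
      hM.zero_mul _, hM.isJoin_zero_left _, hM.dRel_refl hM.idem_one⟩

theorem dRel_of_oplusEq_one (hB : IsBooleanInverseMonoid M) (hD : DPreservesCompl M)
    {e f f' : S} (hf : IsComplPair M e f) (h : OplusEq M e f' M.one) : DRel M f f' := by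
  obtain ⟨e₁, f₁, he₁, hf₁, hee₁, hff₁, h0, hj⟩ := hB.exists_isJoin_of_oplusEq h
  exact hB.invMon.dRel_trans (hD _ _ _ _ hee₁ hf ⟨he₁, hf₁, h0, hj⟩) (hB.invMon.dRel_symm hff₁)

end IsBooleanInverseMonoid

/-- For a Foulis monoid `S` (a completely semisimple Boolean inverse monoid in which `D`
preserves complementation), `(E(S)/D, ⊕, [0], [1])` with complementation `[e]' = [ē]`
is an effect algebra satisfying the refinement property.
(Here `OplusEq M e f g` encodes `[e] ⊕ [f] = [g]`.) -/
theorem effect_algebra_of_foulis_monoid {S : Type} (M : InvMonData S)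
    (hB : IsBooleanInverseMonoid M) (hcss : CompletelySemisimple M)
    (hD : DPreservesCompl M) :
    -- (E1) commutativity
    (∀ e f g, OplusEq M e f g → OplusEq M f e g) ∧
    -- (E2) associativity
    (∀ e f g h, IsIdem M e → IsIdem M f → IsIdem M g →
      ((∃ x, OplusEq M e f x ∧ OplusEq M x g h) ↔
        (∃ y, OplusEq M f g y ∧ OplusEq M e y h))) ∧
    -- (E7) [e] ⊕ [1] is defined iff [e] = [0]
    (∀ e, IsIdem M e → ((∃ g, OplusEq M e M.one g) ↔ DRel M e M.zero)) ∧
    -- (E8) unique complements, given by Boolean complementation: [e]' = [ē]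
    (∀ e, IsIdem M e → ∃ f, IsIdem M f ∧ OplusEq M e f M.one ∧
      ∀ f', IsIdem M f' → OplusEq M e f' M.one → DRel M f f') ∧
    (∀ e e', IsComplPair M e e' → OplusEq M e e' M.one) ∧
    -- the refinement property
    (∀ a₁ a₂ b₁ b₂ v, OplusEq M a₁ a₂ v → OplusEq M b₁ b₂ v →
      ∃ c₁₁ c₁₂ c₂₁ c₂₂, IsIdem M c₁₁ ∧ IsIdem M c₁₂ ∧ IsIdem M c₂₁ ∧ IsIdem M c₂₂ ∧
        OplusEq M c₁₁ c₁₂ a₁ ∧ OplusEq M c₂₁ c₂₂ a₂ ∧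
        OplusEq M c₁₁ c₂₁ b₁ ∧ OplusEq M c₁₂ c₂₂ b₂) := by
  have hM := hB.invMon
  refine ⟨fun _ _ _ => OplusEq.symm hM, fun e f g h _ _ _ => ⟨?_, ?_⟩,
    fun e _ => hB.oplusEq_one_left_iff hcss, fun e he => ?_,
    fun _ _ => hB.oplusEq_one_of_isComplPair, fun _ _ _ _ _ => hB.oplusEq_refinement⟩
  · rintro ⟨x, hx, hh⟩
    exact hB.oplusEq_assoc hx hh
  · rintro ⟨y, hy, hh⟩
    obtain ⟨x, hx, hh'⟩ := hB.oplusEq_assoc (hy.symm hM) (hh.symm hM)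
    exact ⟨x, hx.symm hM, hh'.symm hM⟩
  · obtain ⟨f, hf⟩ := hB.compl_exists e he
    exact ⟨f, hf.2.1, hB.oplusEq_one_of_isComplPair hf,
      fun f' _ h => hB.dRel_of_oplusEq_one hD hf h⟩

end Coordinatization
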